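/- Let p ≥ 3 be an integer and let v be a simple L-periodic arc-length curve of class C⁴ which is strictly convex, i.e. k(s) > 0 for all s. Let (N₀, (s^j)_{j≥0}, (d^j)_{j≥1}) be data of the (S_p, S_{p−2}) normal multiscale transform for v with N₀ ≥ ⌈p/2⌉ + 1, which are convergent, and assume that s^{j−1}_i ≤ s^j_K ≤ s^{j−1}_{i+p+1} whenever j ≥ 1, i ∈ ℤ and 2i ≤ K ≤ 2i + p + 2. For j ≥ 1 and K ∈ ℤ let ξ^j_K ∈ ℝ satisfy v'(ξ^j_K) = w^j_K/|w^j_K| and s^{j−1}_i ≤ ξ^j_K ≤ s^{j−1}_{i+p+1} whenever 2i ≤ K ≤ 2i + p + 2. Then there exists a constant C > 0 such that for all j ≥ 1 and all K ∈ ℤ: |ξ^j_K − s^j_K| ≤ C·(sup_{i∈ℤ} (s^{j−1}_{i+1} − s^{j−1}_i))². -/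

import Mathlib

/-- The Lane–Riesenfeld (B-spline) subdivision operator `S p`, acting on sequences with
values in a real vector space (componentwise averaging). -/
noncomputable def S {E : Type*} [AddCommGroup E] [Module ℝ E] : ℕ → (ℤ → E) → ℤ → E
  | 0, x, i => x (Int.fdiv i 2)
  | p + 1, x, i => (2⁻¹ : ℝ) • (S p x i + S p x (i + 1))

/-- Forward difference operator. -/
def Δ {E : Type*} [AddCommGroup E] (x : ℤ → E) : ℤ → E := fun i => x (i + 1) - x i

/-- Euclidean scalar product on `ℝ²`. -/
noncomputable def dot (u w : ℝ × ℝ) : ℝ := u.1 * w.1 + u.2 * w.2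

/-- Euclidean norm on `ℝ²`. -/
noncomputable def enorm2 (u : ℝ × ℝ) : ℝ := Real.sqrt (u.1 ^ 2 + u.2 ^ 2)

/-- Rotation by 90°: `u^⊥ = (−u₂, u₁)`. -/
def perp (u : ℝ × ℝ) : ℝ × ℝ := (-u.2, u.1)

/-- Signed curvature `k(s) = v''(s)·(v'(s))^⊥` of an arc-length parametrized curve. -/
noncomputable def curv (v : ℝ → ℝ × ℝ) (s : ℝ) : ℝ :=
  dot (deriv (deriv v) s) (perp (deriv v s))

/-- The continuous piecewise-linear interpolant of the data `x : ℤ → ℝ` on the grid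
`2^{−j}ℤ`. -/
noncomputable def plin (j : ℕ) (x : ℤ → ℝ) (t : ℝ) : ℝ :=
  x ⌊(2 : ℝ) ^ j * t⌋ +
    ((2 : ℝ) ^ j * t - (⌊(2 : ℝ) ^ j * t⌋ : ℤ)) * (x (⌊(2 : ℝ) ^ j * t⌋ + 1) - x ⌊(2 : ℝ) ^ j * t⌋)

section Subdivision

variable {E F : Type*} [AddCommGroup E] [Module ℝ E] [AddCommGroup F] [Module ℝ F]

theorem S_map (f : E →ₗ[ℝ] F) (p : ℕ) (x : ℤ → E) (K : ℤ) :
    f (S p x K) = S p (fun k => f (x k)) K := by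
  induction p generalizing K with
  | zero => rfl
  | succ p ih => simp [S, ih]

theorem S_sub (p : ℕ) (x y : ℤ → E) (K : ℤ) :
    S p (fun k => x k - y k) K = S p x K - S p y K := by
  induction p generalizing K with
  | zero => rfl
  | succ p ih => simp only [S, ih, ← smul_sub]; congr 1; abel

theorem S_smul (p : ℕ) (c : ℝ) (x : ℤ → E) (K : ℤ) :
    S p (fun k => c • x k) K = c • S p x K := by
  induction p generalizing K with
  | zero => rfl
  | succ p ih => simp only [S, ih, ← smul_add, smul_comm c]

theorem S_const (p : ℕ) (c : E) (K : ℤ) : S p (fun _ => c) K = c := by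
  induction p generalizing K with
  | zero => rfl
  | succ p ih => simp only [S, ih, ← two_smul ℝ c, smul_smul]; norm_num

/-- Differences of subdivided data are half the subdivided differences, one degree lower. -/
theorem Δ_S_succ (p : ℕ) (x : ℤ → E) (K : ℤ) :
    Δ (S (p + 1) x) K = (2⁻¹ : ℝ) • S p (Δ x) K := by
  induction p generalizing K with
  | zero =>
    have h : Int.fdiv (K + 1 + 1) 2 = Int.fdiv K 2 + 1 := by
      simp only [Int.fdiv_eq_ediv_of_nonneg _ (zero_le_two : (0 : ℤ) ≤ 2)]; omega
    simp only [Δ, S, h, ← smul_sub]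
    congr 1; abel
  | succ p ih =>
    have h1 : Δ (S (p + 1 + 1) x) K =
        (2⁻¹ : ℝ) • (Δ (S (p + 1) x) K + Δ (S (p + 1) x) (K + 1)) := by
      simp only [Δ]
      rw [S, S.eq_2 (p := p + 1), ← smul_sub]
      congr 1; abel
    rw [h1, ih, ih, ← smul_add, S.eq_2 (p := p)]

end Subdivision

theorem abs_S_le {p : ℕ} {x : ℤ → ℝ} {K : ℤ} {B : ℝ}
    (h : ∀ k, K ≤ 2 * k + 1 → 2 * k ≤ K + p → |x k| ≤ B) : |S p x K| ≤ B := by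
  induction p generalizing K with
  | zero =>
    rw [S, Int.fdiv_eq_ediv_of_nonneg _ zero_le_two]
    exact h _ (by omega) (by push_cast; omega)
  | succ p ih =>
    have h1 := ih (K := K) fun k a b => h k a (by push_cast; omega)
    have h2 := ih (K := K + 1) fun k a b => h k (by omega) (by push_cast; omega)
    rw [S, smul_eq_mul, abs_le]
    rw [abs_le] at h1 h2
    constructor <;> linarith [h1.1, h1.2, h2.1, h2.2]

/-- For degree at least three, `S (r + 3) x` agrees with `S (r + 1)` applied to the midpoints
of `x`, up to second differences. -/
theorem abs_S_sub_S_midpoint_le {x : ℤ → ℝ} {B : ℝ} (h : ∀ k, |Δ (Δ x) k| ≤ B) (r : ℕ) (K : ℤ) :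
    |S (r + 3) x K - S (r + 1) (fun k => (x k + x (k + 1)) / 2) K| ≤ B := by
  induction r generalizing K with
  | zero =>
    have hB : 0 ≤ B := (abs_nonneg _).trans (h 0)
    simp only [S, smul_eq_mul, Int.fdiv_eq_ediv_of_nonneg _ (zero_le_two : (0 : ℤ) ≤ 2)]
    obtain ⟨m, rfl | rfl⟩ := Int.even_or_odd' K
    · rw [show (2 * m) / 2 = m by omega, show (2 * m + 1) / 2 = m by omega,
        show (2 * m + 1 + 1) / 2 = m + 1 by omega, show (2 * m + 1 + 1 + 1) / 2 = m + 1 by omega]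
      convert hB using 1
      rw [abs_eq_zero]; ring
    · rw [show (2 * m + 1) / 2 = m by omega,
        show (2 * m + 1 + 1) / 2 = m + 1 by omega, show (2 * m + 1 + 1 + 1) / 2 = m + 1 by omega,
        show (2 * m + 1 + 1 + 1 + 1) / 2 = m + 1 + 1 by omega]
      have := h m
      simp only [Δ, abs_le] at this ⊢
      constructor <;> linarith [this.1, this.2]
  | succ r ih =>
    have h1 := ih K
    have h2 := ih (K + 1)
    rw [S.eq_2 (p := r + 3), S.eq_2 (p := r + 1)]
    simp only [smul_eq_mul, abs_le] at *
    constructor <;> linarith [h1.1, h1.2, h2.1, h2.2]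

/-- Second-order Taylor expansion of a periodic `C⁴` curve with a uniform cubic remainder. -/
theorem exists_taylor_bound {v : ℝ → ℝ × ℝ} {L : ℝ} (hL : 0 < L) (hper : ∀ t, v (t + L) = v t)
    (hreg : ContDiff ℝ 4 v) :
    ∃ B : ℝ, 0 ≤ B ∧ ∀ a t, ‖v t - (v a + (t - a) • deriv v a +
      ((t - a) ^ 2 / 2) • deriv (deriv v) a)‖ ≤ B * |t - a| ^ 3 := by
  have hper1 : ∀ t, deriv v (t + L) = deriv v t := fun t => by
    rw [← deriv_comp_add_const]; simp only [hper]
  have hper2 : ∀ t, deriv (deriv v) (t + L) = deriv (deriv v) t := fun t => by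
    rw [← deriv_comp_add_const]; simp only [hper1]
  have hper3 : Function.Periodic (deriv (deriv (deriv v))) L := fun t => by
    rw [← deriv_comp_add_const]; simp only [hper2]
  have h1 : ContDiff ℝ 3 (deriv v) := ContDiff.deriv' (n := 3) (by exact_mod_cast hreg)
  have h2 : ContDiff ℝ 2 (deriv (deriv v)) := ContDiff.deriv' (n := 2) (by exact_mod_cast h1)
  have h3 : ContDiff ℝ 1 (deriv (deriv (deriv v))) :=
    ContDiff.deriv' (n := 1) (by exact_mod_cast h2)
  have d0 : ∀ t, HasDerivAt v (deriv v t) t := fun t =>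
    (hreg.differentiable (by norm_num) t).hasDerivAt
  have d1 : ∀ t, HasDerivAt (deriv v) (deriv (deriv v) t) t := fun t =>
    (h1.differentiable (by norm_num) t).hasDerivAt
  have d2 : ∀ t, DifferentiableAt ℝ (deriv (deriv v)) t := fun t =>
    h2.differentiable (by norm_num) t
  obtain ⟨B, hB⟩ := (hper3.isBounded_of_continuous hL.ne' h3.continuous).exists_norm_le
  have hB' : ∀ t, ‖deriv (deriv (deriv v)) t‖ ≤ B := fun t => hB _ ⟨t, rfl⟩
  have hB0 : 0 ≤ B := (norm_nonneg _).trans (hB' 0)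
  refine ⟨B, hB0, fun a t => ?_⟩
  have key : ∀ x ∈ Set.uIcc a t, |x - a| ≤ |t - a| := fun x hx => Set.abs_sub_left_of_mem_uIcc hx
  have b2 : ∀ x ∈ Set.uIcc a t, ‖deriv (deriv v) x - deriv (deriv v) a‖ ≤ B * |t - a| :=
    fun x hx => ((convex_uIcc a t).norm_image_sub_le_of_norm_deriv_le (fun y _ => d2 y)
      (fun y _ => hB' y) Set.left_mem_uIcc hx).trans
        (mul_le_mul_of_nonneg_left (key x hx) hB0)
  have b1 : ∀ x ∈ Set.uIcc a t,
      ‖deriv v x - (deriv v a + (x - a) • deriv (deriv v) a)‖ ≤ B * |t - a| ^ 2 := by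
    intro x hx
    have := (convex_uIcc a t).norm_image_sub_le_of_norm_hasDerivWithin_le
      (f := fun y => deriv v y - (deriv v a + (y - a) • deriv (deriv v) a))
      (f' := fun y => deriv (deriv v) y - deriv (deriv v) a)
      (fun y _ => by
        have := (d1 y).sub (((hasDerivAt_const y (deriv v a)).add
          (((hasDerivAt_id y).sub_const a).smul_const (deriv (deriv v) a))))
        refine HasDerivAt.hasDerivWithinAt ?_
        convert this using 1
        · ext y <;> simp
        · simp)
      b2 Set.left_mem_uIcc hx
    simp only [sub_self, zero_smul, add_zero, sub_zero] at this
    refine this.trans ?_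
    rw [pow_two, ← mul_assoc]
    exact mul_le_mul_of_nonneg_left (key x hx) (by positivity)
  have := (convex_uIcc a t).norm_image_sub_le_of_norm_hasDerivWithin_le
    (f := fun y => v y - (v a + (y - a) • deriv v a + ((y - a) ^ 2 / 2) • deriv (deriv v) a))
    (f' := fun y => deriv v y - (deriv v a + (y - a) • deriv (deriv v) a))
    (fun y _ => by
      have h := (d0 y).sub (((hasDerivAt_const y (v a)).add
        (((hasDerivAt_id y).sub_const a).smul_const (deriv v a))).add
        ((((((hasDerivAt_id y).sub_const a).pow 2).div_const 2)).smul_const (deriv (deriv v) a)))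
      refine HasDerivAt.hasDerivWithinAt ?_
      convert h using 1
      · ext y <;> simp
      · simp only [id, one_smul, zero_add]
        congr 3
        push_cast; ring)
    b1 Set.left_mem_uIcc Set.right_mem_uIcc
  simp only [sub_self, zero_smul, add_zero, sub_zero, zero_pow two_ne_zero, zero_div] at this
  refine this.trans (le_of_eq ?_)
  rw [Real.norm_eq_abs]; ring

/-- A null sequence with `a (j + 1) ≤ a j / 2 + C * a j ^ 3` decays like `2⁻ʲ`. -/
theorem exists_le_geometric {a : ℕ → ℝ} {C : ℝ} (ha : ∀ j, 0 ≤ a j)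
    (hlim : Filter.Tendsto a Filter.atTop (nhds 0))
    (hrec : ∀ j, a (j + 1) ≤ a j / 2 + C * a j ^ 3) :
    ∃ M : ℝ, 0 ≤ M ∧ ∀ j, a j ≤ M / 2 ^ j := by
  have hF : Filter.Tendsto (fun j => C * a j + (C * a j ^ 2 + C ^ 2 * a j ^ 4)) Filter.atTop
      (nhds 0) := by
    have := (hlim.const_mul C).add (((hlim.pow 2).const_mul C).add ((hlim.pow 4).const_mul (C ^ 2)))
    simpa using this
  obtain ⟨J, hJ⟩ := Filter.eventually_atTop.1
    (hF.eventually (gt_mem_nhds (by norm_num : (0 : ℝ) < 1 / 4)))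
  have hstep : ∀ j, J ≤ j → a (j + 1) + a (j + 1) ^ 2 ≤ (a j + a j ^ 2) / 2 := by
    intro j hj
    have h1 := hJ j hj
    have h2 := hrec j
    have h3 : a (j + 1) ^ 2 ≤ (a j / 2 + C * a j ^ 3) ^ 2 := pow_le_pow_left₀ (ha _) h2 2
    have h4 := mul_le_mul_of_nonneg_right h1.le (sq_nonneg (a j))
    nlinarith
  have hdec : ∀ n, a (J + n) + a (J + n) ^ 2 ≤ (a J + a J ^ 2) / 2 ^ n := by
    intro n
    induction n with
    | zero => simp
    | succ n ih =>
      have := hstep (J + n) (by omega)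
      rw [← add_assoc, pow_succ (2 : ℝ) n, ← div_div]
      linarith
  refine ⟨∑ j ∈ Finset.range J, a j * 2 ^ j + (a J + a J ^ 2) * 2 ^ J, ?_, fun j => ?_⟩
  · have := ha J
    have : 0 ≤ ∑ j ∈ Finset.range J, a j * 2 ^ j :=
      Finset.sum_nonneg fun j _ => mul_nonneg (ha j) (by positivity)
    positivity
  · rw [le_div_iff₀ (by positivity)]
    have hJ0 : 0 ≤ (a J + a J ^ 2) * 2 ^ J := by have := ha J; positivity
    rcases lt_or_ge j J with h | h
    · have := Finset.single_le_sum (f := fun j => a j * 2 ^ j) (s := Finset.range J)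
        (fun j _ => mul_nonneg (ha j) (by positivity)) (Finset.mem_range.2 h)
      linarith
    · obtain ⟨n, rfl⟩ := Nat.exists_eq_add_of_le h
      have h1 := hdec n
      rw [le_div_iff₀ (by positivity)] at h1
      have h2 : 0 ≤ ∑ j ∈ Finset.range J, a j * 2 ^ j :=
        Finset.sum_nonneg fun j _ => mul_nonneg (ha j) (by positivity)
      have h3 : a (J + n) * 2 ^ n ≤ a J + a J ^ 2 :=
        (mul_le_mul_of_nonneg_right (by nlinarith [sq_nonneg (a (J + n))]) (by positivity)).trans h1
      have h4 := mul_le_mul_of_nonneg_right h3 (by positivity : (0 : ℝ) ≤ 2 ^ J)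
      rw [pow_add]
      nlinarith

theorem plin_eq {j : ℕ} {x : ℤ → ℝ} {t : ℝ} {m : ℤ} (h1 : (m : ℝ) ≤ 2 ^ j * t)
    (h2 : 2 ^ j * t ≤ m + 1) : plin j x t = x m + (2 ^ j * t - m) * (x (m + 1) - x m) := by
  rcases h2.lt_or_eq with h | h
  · have : ⌊(2 : ℝ) ^ j * t⌋ = m := Int.floor_eq_iff.2 ⟨h1, h⟩
    rw [plin, this]
  · have : ⌊(2 : ℝ) ^ j * t⌋ = m + 1 := by
      rw [h]; exact_mod_cast Int.floor_intCast (m + 1)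
    rw [plin, this, h]; push_cast; ring

theorem plin_div (j : ℕ) (x : ℤ → ℝ) (i : ℤ) : plin j x (i / 2 ^ j) = x i := by
  have h : (2 : ℝ) ^ j * (i / 2 ^ j) = i := by field_simp
  rw [plin_eq (m := i) h.ge (by rw [h]; linarith), h]; ring

/-- The scalar product with a fixed vector, as a linear functional. -/
noncomputable def dotLin (u : ℝ × ℝ) : ℝ × ℝ →ₗ[ℝ] ℝ where
  toFun := dot u
  map_add' x y := by simp only [dot, Prod.fst_add, Prod.snd_add]; ring
  map_smul' c x := by
    simp only [dot, Prod.smul_fst, Prod.smul_snd, smul_eq_mul, RingHom.id_apply]; ring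

theorem dot_S (u : ℝ × ℝ) (p : ℕ) (x : ℤ → ℝ × ℝ) (K : ℤ) :
    dot u (S p x K) = S p (fun k => dot u (x k)) K := S_map (dotLin u) p x K

theorem dot_Δ (u : ℝ × ℝ) (x : ℤ → ℝ × ℝ) (k : ℤ) :
    dot u (Δ x k) = Δ (fun k => dot u (x k)) k := (dotLin u).map_sub _ _

theorem abs_dot_le {u w : ℝ × ℝ} {B : ℝ} (hu : dot u u = 1) (hw : ‖w‖ ≤ B) :
    |dot u w| ≤ 2 * B := by
  have hB : 0 ≤ B := (norm_nonneg w).trans hw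
  have h1 : |u.1| ≤ 1 := by
    rw [← sq_le_one_iff_abs_le_one]; simp only [dot] at hu; nlinarith [sq_nonneg u.2]
  have h2 : |u.2| ≤ 1 := by
    rw [← sq_le_one_iff_abs_le_one]; simp only [dot] at hu; nlinarith [sq_nonneg u.1]
  have h3 : |w.1| ≤ B := (norm_fst_le w).trans hw
  have h4 : |w.2| ≤ B := (norm_snd_le w).trans hw
  calc |dot u w| ≤ |u.1 * w.1| + |u.2 * w.2| := abs_add_le _ _
    _ = |u.1| * |w.1| + |u.2| * |w.2| := by rw [abs_mul, abs_mul]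
    _ ≤ 1 * B + 1 * B := by gcongr
    _ = 2 * B := by ring

/-- Tangential and normal Taylor expansions of an arc-length parametrized curve. -/
theorem exists_frenet_bound {v : ℝ → ℝ × ℝ} {L : ℝ} (hL : 0 < L) (hper : ∀ t, v (t + L) = v t)
    (hreg : ContDiff ℝ 4 v) (hunit : ∀ t, dot (deriv v t) (deriv v t) = 1) :
    ∃ B : ℝ, 0 ≤ B ∧ ∀ a t,
      |dot (deriv v a) (v t) - t - (dot (deriv v a) (v a) - a)| ≤ B * |t - a| ^ 3 ∧
      |dot (perp (deriv v a)) (v t) - curv v a / 2 * (t - a) ^ 2 - dot (perp (deriv v a)) (v a)|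
        ≤ B * |t - a| ^ 3 := by
  obtain ⟨B, hB, h⟩ := exists_taylor_bound hL hper hreg
  have h1 : ContDiff ℝ 3 (deriv v) := ContDiff.deriv' (n := 3) (by exact_mod_cast hreg)
  refine ⟨2 * B, by positivity, fun a t => ?_⟩
  have d1 : HasDerivAt (deriv v) (deriv (deriv v) a) a :=
    (h1.differentiable (by norm_num) a).hasDerivAt
  have hortho : dot (deriv v a) (deriv (deriv v) a) = 0 := by
    have e1 : HasDerivAt (fun t => (deriv v t).1) (deriv (deriv v) a).1 a :=
      (hasFDerivAt_fst (𝕜 := ℝ) (p := deriv v a)).comp_hasDerivAt a d1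
    have e2 : HasDerivAt (fun t => (deriv v t).2) (deriv (deriv v) a).2 a :=
      (hasFDerivAt_snd (𝕜 := ℝ) (p := deriv v a)).comp_hasDerivAt a d1
    have e3 := (e1.mul e1).add (e2.mul e2)
    have e4 : HasDerivAt (fun t => dot (deriv v t) (deriv v t)) 0 a := by
      simp only [hunit]; exact hasDerivAt_const a 1
    have := e3.unique e4
    simp only [dot]; linarith
  have hunit' : dot (perp (deriv v a)) (perp (deriv v a)) = 1 := by
    rw [← hunit a]; simp only [dot, perp]; ring
  constructor
  · have := abs_dot_le (hunit a) (h a t)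
    rw [← mul_assoc] at this
    convert this using 2
    have e := hunit a
    simp only [dot, Prod.fst_sub, Prod.snd_sub, Prod.fst_add, Prod.snd_add, Prod.smul_fst,
      Prod.smul_snd, smul_eq_mul] at *
    linear_combination (t - a) * e + ((t - a) ^ 2 / 2) * hortho
  · have := abs_dot_le hunit' (h a t)
    rw [← mul_assoc] at this
    convert this using 2
    simp only [curv, dot, perp, Prod.fst_sub, Prod.snd_sub, Prod.fst_add, Prod.snd_add,
      Prod.smul_fst, Prod.smul_snd, smul_eq_mul]
    ring

theorem exists_curv_lower_bound {v : ℝ → ℝ × ℝ} {L : ℝ} (hL : 0 < L)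
    (hper : ∀ t, v (t + L) = v t) (hreg : ContDiff ℝ 4 v) (hconvex : ∀ t, 0 < curv v t) :
    ∃ κ : ℝ, 0 < κ ∧ ∀ t, κ ≤ curv v t := by
  have h1 : ContDiff ℝ 3 (deriv v) := ContDiff.deriv' (n := 3) (by exact_mod_cast hreg)
  have h2 : ContDiff ℝ 2 (deriv (deriv v)) := ContDiff.deriv' (n := 2) (by exact_mod_cast h1)
  have hper1 : ∀ t, deriv v (t + L) = deriv v t := fun t => by
    rw [← deriv_comp_add_const]; simp only [hper]
  have hper2 : ∀ t, deriv (deriv v) (t + L) = deriv (deriv v) t := fun t => by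
    rw [← deriv_comp_add_const]; simp only [hper1]
  have hcurv : Function.Periodic (curv v) L := fun t => by simp only [curv, hper1, hper2]
  have c1 := h1.continuous
  have c2 := h2.continuous
  have hcont : Continuous (curv v) := by unfold curv dot perp; fun_prop
  obtain ⟨m, -, hm⟩ := isCompact_Icc.exists_isMinOn
    (Set.nonempty_Icc.2 hL.le) hcont.continuousOn
  refine ⟨curv v m, hconvex m, fun t => ?_⟩
  obtain ⟨y, hy, hty⟩ := hcurv.exists_mem_Ico₀ hL t
  rw [hty]
  exact hm (Set.Ico_subset_Icc_self hy)

/-- Subdivision of a function close to the constant `c` on the stencil is close to `c`. -/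
theorem abs_S_sub_const_le {p : ℕ} {x : ℤ → ℝ} {K : ℤ} {B c : ℝ}
    (h : ∀ k, K ≤ 2 * k + 1 → 2 * k ≤ K + p → |x k - c| ≤ B) : |S p x K - c| ≤ B := by
  have := abs_S_le (x := fun k => x k - c) h
  rwa [S_sub, S_const] at this

/-- The subdivided parameters are a third-order approximation of the parameter of the point
found in normal direction. -/
theorem abs_sub_S_le {v : ℝ → ℝ × ℝ} {p : ℕ} {x : ℤ → ℝ} {K : ℤ} {a σ e B H : ℝ} {w : ℝ × ℝ}
    (hB : 0 ≤ B)
    (hT : ∀ t, |dot (deriv v a) (v t) - t - (dot (deriv v a) (v a) - a)| ≤ B * |t - a| ^ 3)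
    (hx : ∀ k, K ≤ 2 * k + 1 → 2 * k ≤ K + p → |x k - a| ≤ H) (hσ : |σ - a| ≤ H)
    (hw : dot (deriv v a) (perp w) = 0)
    (hv : v σ = S p (fun k => v (x k)) K + e • perp w) :
    |σ - S p x K| ≤ 2 * B * H ^ 3 := by
  have hT' : ∀ t, |t - a| ≤ H →
      |dot (deriv v a) (v t) - t - (dot (deriv v a) (v a) - a)| ≤ B * H ^ 3 := fun t ht =>
    (hT t).trans (by gcongr)
  have h1 : dot (deriv v a) (v σ) = S p (fun k => dot (deriv v a) (v (x k))) K := by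
    rw [hv, ← dot_S, ← add_zero (dot _ (S _ _ _)), ← mul_zero e, ← hw]
    exact ((dotLin (deriv v a)).map_add _ _).trans
      (congrArg _ ((dotLin (deriv v a)).map_smul _ _))
  have h2 := hT' σ hσ
  have h3 := abs_S_sub_const_le (x := fun k => dot (deriv v a) (v (x k)) - x k)
    fun k hk hk' => hT' _ (hx k hk hk')
  rw [S_sub, ← h1] at h3
  rw [abs_le] at *
  constructor <;> linarith [h2.1, h2.2, h3.1, h3.2]

/-- If the subdivided secants are parallel to the tangent at `a`, then the subdivided
differences of `(x - a) ^ 2` are of third order. -/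
theorem abs_S_Δ_sq_le {v : ℝ → ℝ × ℝ} {m : ℕ} {x : ℤ → ℝ} {K : ℤ} {a B H κ : ℝ}
    (hB : 0 ≤ B) (hκ : 0 < κ) (hcurv : κ ≤ curv v a)
    (hT : ∀ t, |dot (perp (deriv v a)) (v t) - curv v a / 2 * (t - a) ^ 2 -
      dot (perp (deriv v a)) (v a)| ≤ B * |t - a| ^ 3)
    (hx : ∀ k, K ≤ 2 * k + 1 → 2 * k ≤ K + m + 2 → |x k - a| ≤ H)
    (hw : dot (perp (deriv v a)) (S m (Δ fun k => v (x k)) K) = 0) :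
    |S m (Δ fun k => (x k - a) ^ 2) K| ≤ 4 * B / κ * H ^ 3 := by
  have hT' : ∀ k, K ≤ 2 * k + 1 → 2 * k ≤ K + m + 2 →
      |dot (perp (deriv v a)) (v (x k)) - curv v a / 2 * (x k - a) ^ 2 -
        dot (perp (deriv v a)) (v a)| ≤ B * H ^ 3 := fun k h h' =>
    (hT _).trans (by have := hx k h h'; gcongr)
  have h1 : |S m (fun k => Δ (fun k => dot (perp (deriv v a)) (v (x k))) k -
      (curv v a / 2) • Δ (fun k => (x k - a) ^ 2) k) K| ≤ 2 * B * H ^ 3 := by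
    refine abs_S_le fun k hk hk' => ?_
    have e1 := hT' k hk (by omega)
    have e2 := hT' (k + 1) (by omega) (by omega)
    simp only [Δ, smul_eq_mul]
    rw [abs_le] at *
    constructor <;> linarith [e1.1, e1.2, e2.1, e2.2]
  rw [S_sub, S_smul] at h1
  rw [dot_S] at hw
  simp only [dot_Δ] at hw
  rw [hw, zero_sub, abs_neg, smul_eq_mul, abs_mul, abs_of_pos (by linarith)] at h1
  rw [div_mul_eq_mul_div, le_div_iff₀ hκ]
  have := mul_le_mul_of_nonneg_right hcurv (abs_nonneg (S m (Δ fun k => (x k - a) ^ 2) K))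
  linarith

/-- The maximal step of a sequence of refining periodic parametrizations with uniformly
convergent interpolants tends to zero. -/
theorem exists_forall_step_le {s : ℕ → ℤ → ℝ} {N : ℕ} {L : ℝ} (hN : 1 ≤ N)
    (hmono : ∀ j, StrictMono (s j))
    (hsper : ∀ (j : ℕ) (i : ℤ), s j (i + N * 2 ^ j) = s j i + L)
    (hstep : ∀ j i, s j (i + 1) - s j i ≤ L) {slim : ℝ → ℝ}
    (hconv : TendstoUniformlyOn (fun j => plin j (s j)) slim Filter.atTop (Set.Icc 0 (N : ℝ)))
    {ε : ℝ} (hε : 0 < ε) : ∃ J, ∀ j, J ≤ j → ∀ i, s j (i + 1) - s j i ≤ ε := by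
  obtain ⟨J, hJ⟩ := Filter.eventually_atTop.1
    (Metric.tendstoUniformlyOn_iff.1 hconv (ε / 5) (by positivity))
  obtain ⟨n₀, hn₀⟩ := exists_pow_lt_of_lt_one (x := ε / 5 / (|L| + 1)) (by positivity)
    (by norm_num : (1 / 2 : ℝ) < 1)
  refine ⟨J + n₀, fun j hj i => ?_⟩
  obtain ⟨n, rfl⟩ := Nat.exists_eq_add_of_le (show J ≤ j by omega)
  have hn : n₀ ≤ n := by omega
  wlog hi : 0 ≤ i ∧ i < N * 2 ^ (J + n) generalizing i with H
  · have hP : (0 : ℤ) < N * 2 ^ (J + n) := by positivity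
    have hsperm : Function.Periodic (fun i => s (J + n) (i + 1) - s (J + n) i)
        (N * 2 ^ (J + n) : ℤ) := fun i => by
      have h1 := hsper (J + n) i
      have h2 := hsper (J + n) (i + 1)
      rw [add_right_comm] at h2
      simp only [h1, h2]; ring
    obtain ⟨y, hy, hiy⟩ := hsperm.exists_mem_Ico₀ hP i
    exact hiy.trans_le (H y hy)
  obtain ⟨hi0, hi1⟩ := hi
  have hi1' : i + 1 ≤ N * 2 ^ (J + n) := hi1
  have hP : (0 : ℝ) < 2 ^ (J + n) := by positivity
  have hi0r : (0 : ℝ) ≤ i := by exact_mod_cast hi0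
  have hi1r : (i : ℝ) + 1 ≤ N * 2 ^ (J + n) := by exact_mod_cast hi1'
  have mem0 : (i : ℝ) / 2 ^ (J + n) ∈ Set.Icc 0 (N : ℝ) :=
    ⟨by positivity, by rw [div_le_iff₀ hP]; linarith⟩
  have mem1 : ((i + 1 : ℤ) : ℝ) / 2 ^ (J + n) ∈ Set.Icc 0 (N : ℝ) := by
    push_cast
    exact ⟨by positivity, by rw [div_le_iff₀ hP]; linarith⟩
  have a1 := hJ (J + n) (by omega) _ mem0
  have a2 := hJ (J + n) (by omega) _ mem1
  have a3 := hJ J le_rfl _ mem0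
  have a4 := hJ J le_rfl _ mem1
  rw [plin_div] at a1 a2
  have hQ : (0 : ℤ) < 2 ^ n := by positivity
  set m := i / 2 ^ n with hm
  have m0 : m * 2 ^ n ≤ i := Int.ediv_mul_le i hQ.ne'
  have m1 : i + 1 ≤ (m + 1) * 2 ^ n := Int.lt_ediv_add_one_mul_self i hQ
  have m0r : (m : ℝ) * 2 ^ n ≤ i := by exact_mod_cast m0
  have m1r : (i : ℝ) + 1 ≤ (m + 1) * 2 ^ n := by exact_mod_cast m1
  have hQr : (0 : ℝ) < 2 ^ n := by positivity
  have c0 : (2 : ℝ) ^ J * (i / 2 ^ (J + n)) = i / 2 ^ n := by rw [pow_add]; field_simp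
  have c1 : (2 : ℝ) ^ J * (((i + 1 : ℤ) : ℝ) / 2 ^ (J + n)) = (i + 1) / 2 ^ n := by
    rw [pow_add]; push_cast; field_simp
  rw [plin_eq (m := m) (by rw [c0, le_div_iff₀ hQr]; exact m0r)
    (by rw [c0, div_le_iff₀ hQr]; linarith), c0] at a3
  rw [plin_eq (m := m) (by rw [c1, le_div_iff₀ hQr]; linarith)
    (by rw [c1, div_le_iff₀ hQr]; exact m1r), c1] at a4
  have hsmall : (1 / 2 ^ n : ℝ) * (s J (m + 1) - s J m) ≤ ε / 5 := by
    have h1 : (1 / 2 : ℝ) ^ n ≤ (1 / 2) ^ n₀ :=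
      pow_le_pow_of_le_one (by norm_num) (by norm_num) hn
    rw [← one_div_pow]
    calc (1 / 2 : ℝ) ^ n * (s J (m + 1) - s J m) ≤ ε / 5 / (|L| + 1) * (|L| + 1) := by
          gcongr
          · linarith [hmono J (lt_add_one m)]
          · exact h1.trans hn₀.le
          · linarith [hstep J m, le_abs_self L]
      _ = ε / 5 := div_mul_cancel₀ _ (by positivity)
  have hsplit : ((i : ℝ) + 1) / 2 ^ n = i / 2 ^ n + 1 / 2 ^ n := add_div _ _ _
  rw [hsplit] at a4
  rw [Real.dist_eq, abs_lt] at a1 a2 a3 a4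
  linarith [a1.1, a2.2, a3.1, a4.2, a1.2, a2.1, a3.2, a4.1]

/-- If the parameters are `S p`-subdivided up to cubically small errors, second differences
decay quadratically. -/
theorem exists_Δ_Δ_le {s : ℕ → ℤ → ℝ} {r : ℕ} {G A : ℝ} (hG : 0 ≤ G)
    (hA : ∀ i, |Δ (Δ (s 0)) i| ≤ A)
    (h : ∀ j K, |s (j + 1) K - S (r + 2) (s j) K| ≤ G / 8 ^ j) :
    ∃ E : ℝ, ∀ j i, |Δ (Δ (s j)) i| ≤ E / 4 ^ j := by
  have key : ∀ j i, |Δ (Δ (s j)) i| ≤ (A + 32 * G - 32 * G / 2 ^ j) / 4 ^ j := by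
    intro j
    induction j with
    | zero => intro i; simpa using hA i
    | succ j ih =>
      intro i
      have e0 := h j i
      have e1 := h j (i + 1)
      have e2 := h j (i + 1 + 1)
      have h1 : ∀ K, Δ (S (r + 2) (s j)) K = (2⁻¹ : ℝ) • S (r + 1) (Δ (s j)) K :=
        Δ_S_succ (r + 1) (s j)
      have h2 := Δ_S_succ r (Δ (s j)) i
      have h3 : Δ (Δ (S (r + 2) (s j))) i = 4⁻¹ * S r (Δ (Δ (s j))) i := by
        rw [Δ, h1, h1, ← smul_sub, ← Δ, h2, smul_smul, smul_eq_mul]; norm_num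
      have h4 := abs_S_le (p := r) (K := i) fun k _ _ => ih k
      have h5 : (A + 32 * G - 32 * G / 2 ^ (j + 1)) / 4 ^ (j + 1) =
          4⁻¹ * ((A + 32 * G - 32 * G / 2 ^ j) / 4 ^ j) + 4 * (G / 8 ^ j) := by
        have : (8 : ℝ) ^ j = 4 ^ j * 2 ^ j := by rw [← mul_pow]; norm_num
        rw [this]; field_simp; ring
      rw [h5]
      simp only [Δ] at h3 h4 ⊢
      rw [abs_le] at *
      constructor <;> linarith [e0.1, e0.2, e1.1, e1.2, e2.1, e2.2, h4.1, h4.2]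
  refine ⟨A + 32 * G, fun j i => (key j i).trans ?_⟩
  gcongr
  linarith [show 0 ≤ 32 * G / 2 ^ j by positivity]

theorem sub_le_mul_of_Δ_le {x : ℤ → ℝ} {B : ℝ} {i : ℤ} {P : ℕ}
    (h : ∀ n : ℕ, n < P → Δ x (i + n) ≤ B) : ∀ n : ℕ, n ≤ P → x (i + n) - x i ≤ n * B := by
  intro n
  induction n with
  | zero => simp
  | succ n ih =>
    intro hn
    have h1 := ih (by omega)
    have h2 := h n (by omega)
    rw [Δ, add_assoc] at h2
    push_cast
    linarith

theorem abs_Δ_sub_Δ_le {x : ℤ → ℝ} {B : ℝ} (h : ∀ k, |Δ (Δ x) k| ≤ B) (i : ℤ) (n : ℕ) :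
    |Δ x (i + n) - Δ x i| ≤ n * B := by
  induction n with
  | zero => simp
  | succ n ih =>
    have h1 := h (i + n)
    rw [Δ, add_assoc] at h1
    push_cast
    rw [abs_le] at *
    constructor <;> linarith [h1.1, h1.2, ih.1, ih.2]

/-- The parameter `a` at which `(x - a) ^ 2` has small subdivided differences is close to any
`σ` that is close to the subdivided parameters. -/
theorem abs_sub_le_of_S_Δ_sq_le {r P : ℕ} {x : ℤ → ℝ} {K i : ℤ} {a σ h D C₁ C₂ L : ℝ}
    (hP : P = r + 4) (hK : 2 * i ≤ K) (hK' : K ≤ 2 * i + 1) (hmono : StrictMono x)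
    (hh : ∀ k, Δ x k ≤ h) (hL : h ≤ L) (hD0 : 0 ≤ D) (hC₁ : 0 ≤ C₁) (hC₂ : 0 ≤ C₂)
    (hD : ∀ k, |Δ (Δ x) k| ≤ D * h ^ 2)
    (ha : x i ≤ a) (ha' : a ≤ x (i + P)) (hσ : x i ≤ σ) (hσ' : σ ≤ x (i + P))
    (hS : |σ - S (r + 3) x K| ≤ C₁ * (x (i + P) - x i) ^ 3)
    (hq : |S (r + 1) (Δ fun k => (x k - a) ^ 2) K| ≤ C₂ * (x (i + P) - x i) ^ 3) :
    |a - σ| ≤ (P * (1 + P * D) * (1 + (C₂ * P ^ 2 + 2 * P * D) / 2) + D + C₁ * P ^ 3 * L) *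
      h ^ 2 := by
  have hpos : ∀ k, 0 < Δ x k := fun k => sub_pos.2 (hmono (lt_add_one k))
  have hh0 : 0 < h := (hpos 0).trans_le (hh 0)
  have hHh : x (i + P) - x i ≤ P * h := sub_le_mul_of_Δ_le (fun n _ => hh _) P le_rfl
  have hvar : ∀ n : ℕ, n ≤ P → |Δ x (i + n) - Δ x i| ≤ P * D * h ^ 2 := fun n hn =>
    (abs_Δ_sub_Δ_le hD i n).trans (by
      rw [mul_assoc]
      have : (n : ℝ) ≤ P := by exact_mod_cast hn
      gcongr)
  have hHq : x (i + P) - x i ≤ P * (Δ x i + P * D * h ^ 2) :=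
    sub_le_mul_of_Δ_le (fun n hn => by linarith [(abs_le.1 (hvar n hn.le)).2]) P le_rfl
  have hH0 : 0 ≤ x (i + P) - x i := by linarith
  set H := x (i + P) - x i with hH
  set q := Δ x i with hqdef
  have hq0 : 0 < q := hpos i
  have hext : 0 ≤ D + C₁ * P ^ 3 * L := by
    have : 0 ≤ L := hh0.le.trans hL
    positivity
  rcases le_or_gt q (h ^ 2) with hsmall | hlarge
  · have h1 : |a - σ| ≤ H := by rw [abs_le]; constructor <;> linarith
    have h2 : H ≤ P * (1 + P * D) * h ^ 2 := by
      refine hHq.trans ?_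
      rw [mul_assoc (P : ℝ) (1 + P * D)]
      refine mul_le_mul_of_nonneg_left ?_ (Nat.cast_nonneg P)
      linarith
    refine h1.trans (h2.trans (mul_le_mul_of_nonneg_right ?_ (by positivity)))
    have : 0 ≤ P * (1 + P * D) * ((C₂ * P ^ 2 + 2 * P * D) / 2) := by positivity
    linarith
  · have hHA : H ≤ P * (1 + P * D) * q := by
      refine hHq.trans ?_
      rw [mul_assoc (P : ℝ) (1 + P * D)]
      refine mul_le_mul_of_nonneg_left ?_ (Nat.cast_nonneg P)
      have := mul_le_mul_of_nonneg_left hlarge.le (show 0 ≤ P * D by positivity)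
      linarith
    set y : ℤ → ℝ := fun k => (x k + x (k + 1)) / 2 with hy
    have hmid : |S (r + 3) x K - S (r + 1) y K| ≤ D * h ^ 2 := abs_S_sub_S_midpoint_le hD r K
    have hlin : |S (r + 1) (fun k => Δ (fun k => (x k - a) ^ 2) k - (2 * q) • (y k - a)) K| ≤
        2 * P * D * h ^ 2 * H := by
      refine abs_S_le fun k hk hk' => ?_
      obtain ⟨n, rfl⟩ := Int.le.dest (show i ≤ k by omega)
      have hn : n + 1 ≤ P := by push_cast at hk'; omega
      have b1 := hvar n (by omega)
      have b2 : |(x (i + n) + x (i + n + 1)) - 2 * a| ≤ 2 * H := by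
        have m1 : x i ≤ x (i + n) := hmono.monotone (by omega)
        have m2 : x i ≤ x (i + n + 1) := hmono.monotone (by omega)
        have m3 : x (i + n) ≤ x (i + P) := hmono.monotone (by omega)
        have m4 : x (i + n + 1) ≤ x (i + P) := hmono.monotone (by omega)
        rw [abs_le]; constructor <;> linarith
      have b3 : Δ (fun k => (x k - a) ^ 2) (i + n) - (2 * q) • (y (i + n) - a) =
          (Δ x (i + n) - q) * ((x (i + n) + x (i + n + 1)) - 2 * a) := by
        simp only [Δ, hy, smul_eq_mul]; ring
      rw [b3, abs_mul]
      calc _ ≤ P * D * h ^ 2 * (2 * H) := by gcongr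
        _ = _ := by ring
    rw [S_sub, S_smul, S_sub, S_const, smul_eq_mul] at hlin
    have hmain : 2 * q * |S (r + 1) y K - a| ≤ (C₂ * H ^ 2 + 2 * P * D * h ^ 2) * H := by
      rw [← abs_of_pos (show 0 < 2 * q by positivity), ← abs_mul]
      rw [abs_le] at *
      constructor <;> linarith [hlin.1, hlin.2, hq.1, hq.2]
    have hmain' : |S (r + 1) y K - a| ≤
        P * (1 + P * D) * ((C₂ * P ^ 2 + 2 * P * D) / 2) * h ^ 2 := by
      refine le_of_mul_le_mul_left (hmain.trans ?_) (show 0 < 2 * q by positivity)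
      calc (C₂ * H ^ 2 + 2 * P * D * h ^ 2) * H
          ≤ (C₂ * (P * h) ^ 2 + 2 * P * D * h ^ 2) * (P * (1 + P * D) * q) := by gcongr
        _ = _ := by ring
    have hS' : C₁ * H ^ 3 ≤ C₁ * P ^ 3 * L * h ^ 2 := by
      calc C₁ * H ^ 3 ≤ C₁ * (P * h) ^ 3 := by gcongr
        _ = C₁ * P ^ 3 * h * h ^ 2 := by ring
        _ ≤ _ := by gcongr
    have hpart : 0 ≤ P * (1 + P * D) * h ^ 2 := by positivity
    have hS'' := hS.trans hS'
    rw [abs_le] at *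
    constructor <;> linarith [hS''.1, hS''.2, hmid.1, hmid.2, hmain'.1, hmain'.2]

/-- Proposition 3.2: for `p ≥ 3` and a strictly convex simple closed `C⁴` arc-length curve,
the parameters `ξ^j_K` of the approximate normals of a convergent `(S_p, S_{p−2})` normal
multiscale transform satisfy `|ξ^j_K − s^j_K| ≤ C·‖Δ s^{j−1}‖²`. -/
theorem Sp_Spm2_normal_proximity (p : ℕ) (hp : 3 ≤ p)
    (L : ℝ) (hL : 0 < L) (v : ℝ → ℝ × ℝ) (hper : ∀ t, v (t + L) = v t)
    (hreg : ContDiff ℝ 4 v) (hunit : ∀ t, dot (deriv v t) (deriv v t) = 1)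
    (hsimple : Set.InjOn v (Set.Ico 0 L))
    (hconvex : ∀ t, 0 < curv v t)
    (N₀ : ℕ) (hN₀ : (p + 1) / 2 + 1 ≤ N₀)
    (s : ℕ → ℤ → ℝ) (hmono : ∀ j, StrictMono (s j))
    (hsper : ∀ (j : ℕ) (i : ℤ), s j (i + N₀ * 2 ^ j) = s j i + L)
    (d : ℕ → ℤ → ℝ)
    (hdata : ∀ j : ℕ, 1 ≤ j → ∀ K : ℤ,
      S (p - 2) (Δ fun k => v (s (j - 1) k)) K ≠ 0 ∧
      v (s j K) = S p (fun k => v (s (j - 1) k)) K +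
        (d j K / enorm2 (S (p - 2) (Δ fun k => v (s (j - 1) k)) K)) •
          perp (S (p - 2) (Δ fun k => v (s (j - 1) k)) K))
    (hloc : ∀ j : ℕ, 1 ≤ j → ∀ i K : ℤ, 2 * i ≤ K → K ≤ 2 * i + p + 2 →
      s (j - 1) i ≤ s j K ∧ s j K ≤ s (j - 1) (i + p + 1))
    (slim : ℝ → ℝ)
    (hconv : ∀ A : Set ℝ, IsCompact A →
      TendstoUniformlyOn (fun j => plin j (s j)) slim Filter.atTop A)
    (ξ : ℕ → ℤ → ℝ)
    (hξtan : ∀ j : ℕ, 1 ≤ j → ∀ K : ℤ,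
      deriv v (ξ j K) = (enorm2 (S (p - 2) (Δ fun k => v (s (j - 1) k)) K))⁻¹ •
        S (p - 2) (Δ fun k => v (s (j - 1) k)) K)
    (hξloc : ∀ j : ℕ, 1 ≤ j → ∀ i K : ℤ, 2 * i ≤ K → K ≤ 2 * i + p + 2 →
      s (j - 1) i ≤ ξ j K ∧ ξ j K ≤ s (j - 1) (i + p + 1)) :
    ∃ C : ℝ, 0 < C ∧ ∀ j : ℕ, 1 ≤ j → ∀ K : ℤ,
      |ξ j K - s j K| ≤ C * (⨆ i : ℤ, (s (j - 1) (i + 1) - s (j - 1) i)) ^ 2 := by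
  obtain ⟨r, rfl⟩ : ∃ r, p = r + 3 := ⟨p - 3, by omega⟩
  simp only [show r + 3 - 2 = r + 1 by omega] at hdata hξtan
  have hN : 1 ≤ N₀ := by omega
  obtain ⟨B, hB, hfrenet⟩ := exists_frenet_bound hL hper hreg hunit
  obtain ⟨κ, hκ, hcurv⟩ := exists_curv_lower_bound hL hper hreg hconvex
  have hΔL : ∀ j i, Δ (s j) i ≤ L := fun j i => by
    have h1 : s j (i + 1) ≤ s j (i + N₀ * 2 ^ j) := (hmono j).monotone (by
      have : (0 : ℤ) < N₀ * 2 ^ j := by positivity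
      omega)
    rw [Δ]
    linarith [hsper j i]
  have hΔ0 : ∀ j i, 0 < Δ (s j) i := fun j i => sub_pos.2 (hmono j (lt_add_one i))
  have hbdd : ∀ j, BddAbove (Set.range (Δ (s j))) := fun j =>
    ⟨L, by rintro _ ⟨i, rfl⟩; exact hΔL j i⟩
  obtain ⟨a, ha⟩ : ∃ a : ℕ → ℝ, ∀ j, a j = ⨆ i : ℤ, (s j (i + 1) - s j i) := ⟨_, fun _ => rfl⟩
  have hΔa : ∀ j i, Δ (s j) i ≤ a j := fun j i => (ha j).symm ▸ le_ciSup (hbdd j) i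
  have ha_le : ∀ j c, (∀ i, Δ (s j) i ≤ c) → a j ≤ c := fun j c hc =>
    (ha j).symm ▸ ciSup_le hc
  have ha0 : ∀ j, 0 < a j := fun j => (hΔ0 j 0).trans_le (hΔa j 0)
  -- local geometry of one refinement step
  set P : ℕ := r + 4 with hP
  have hlocal : ∀ j K i, 2 * i ≤ K → K ≤ 2 * i + 1 →
      |s (j + 1) K - S (r + 3) (s j) K| ≤ 2 * B * (s j (i + P) - s j i) ^ 3 ∧
      |S (r + 1) (Δ fun k => (s j k - ξ (j + 1) K) ^ 2) K| ≤
        4 * B / κ * (s j (i + P) - s j i) ^ 3 ∧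
      (s j i ≤ s (j + 1) K ∧ s (j + 1) K ≤ s j (i + P)) ∧
      (s j i ≤ ξ (j + 1) K ∧ ξ (j + 1) K ≤ s j (i + P)) := by
    intro j K i hi hi'
    have hcast : i + ((r + 3 : ℕ) : ℤ) + 1 = i + P := by rw [hP]; push_cast; ring
    have b1 := hloc (j + 1) (by omega) i K hi (by push_cast; omega)
    have b2 := hξloc (j + 1) (by omega) i K hi (by push_cast; omega)
    obtain ⟨hw0, hw⟩ := hdata (j + 1) (by omega) K
    have htan := hξtan (j + 1) (by omega) K
    rw [hcast] at b1 b2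
    simp only [Nat.add_sub_cancel] at b1 b2 hw0 hw htan
    have hx : ∀ k, K ≤ 2 * k + 1 → 2 * k ≤ K + r + 3 →
        |s j k - ξ (j + 1) K| ≤ s j (i + P) - s j i := fun k hk hk' => by
      have m1 : s j i ≤ s j k := (hmono j).monotone (by omega)
      have m2 : s j k ≤ s j (i + P) := (hmono j).monotone (by omega)
      rw [abs_le]; constructor <;> linarith [b2.1, b2.2]
    refine ⟨abs_sub_S_le hB (fun t => (hfrenet (ξ (j + 1) K) t).1)
      (fun k hk hk' => hx k hk (by push_cast at hk'; omega))
      (by rw [abs_le]; constructor <;> linarith [b1.1, b1.2, b2.1, b2.2]) ?_ hw,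
      abs_S_Δ_sq_le hB hκ (hcurv _) (fun t => (hfrenet (ξ (j + 1) K) t).2)
      (fun k hk hk' => hx k hk (by push_cast at hk'; omega)) ?_, b1, b2⟩
    · rw [htan, dot]
      simp only [perp, Prod.smul_fst, Prod.smul_snd, smul_eq_mul]
      ring
    · rw [htan, dot]
      simp only [perp, Prod.smul_fst, Prod.smul_snd, smul_eq_mul]
      ring
  have hsup : ∀ j i, s j (i + P) - s j i ≤ P * a j := fun j i =>
    sub_le_mul_of_Δ_le (fun n _ => hΔa j _) P le_rfl
  have hlin : ∀ j K, |s (j + 1) K - S (r + 3) (s j) K| ≤ 2 * B * (P * a j) ^ 3 := fun j K => by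
    have h1 := (hlocal j K (K / 2) (by omega) (by omega)).1
    have h2 : 0 ≤ s j (K / 2 + P) - s j (K / 2) := sub_nonneg.2 ((hmono j).monotone (by omega))
    have h3 := hsup j (K / 2)
    exact h1.trans (by gcongr)
  -- decay of first differences
  have hlim : Filter.Tendsto a Filter.atTop (nhds 0) := by
    rw [Metric.tendsto_atTop]
    intro ε hε
    obtain ⟨J, hJ⟩ := exists_forall_step_le hN hmono hsper hΔL (hconv _ isCompact_Icc)
      (half_pos hε)
    refine ⟨J, fun j hj => ?_⟩
    rw [Real.dist_0_eq_abs, abs_of_pos (ha0 j)]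
    exact (ha_le j _ (hJ j hj)).trans_lt (half_lt_self hε)
  have hrec : ∀ j, a (j + 1) ≤ a j / 2 + 4 * B * P ^ 3 * a j ^ 3 := fun j => by
    refine ha_le _ _ fun K => ?_
    have h1 := abs_le.1 (hlin j K)
    have h2 := abs_le.1 (hlin j (K + 1))
    have h3 := Δ_S_succ (r + 2) (s j) K
    have h4 : |S (r + 2) (Δ (s j)) K| ≤ a j := abs_S_le fun k _ _ => by
      rw [abs_of_pos (hΔ0 j k)]; exact hΔa j k
    rw [Δ, smul_eq_mul] at h3
    rw [Δ]
    rw [mul_pow] at h1 h2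
    linarith [h1.1, h1.2, h2.1, h2.2, (abs_le.1 h4).2]
  obtain ⟨M, hM, haM⟩ := exists_le_geometric (fun j => (ha0 j).le) hlim hrec
  -- decay of second differences
  obtain ⟨E, hE⟩ := exists_Δ_Δ_le (r := r + 1) (G := 2 * B * (P * M) ^ 3) (A := L) (by positivity)
    (fun i => by
      have h1 := hΔ0 0 i
      have h2 := hΔ0 0 (i + 1)
      have h3 := hΔL 0 i
      have h4 := hΔL 0 (i + 1)
      rw [Δ, abs_le]; constructor <;> linarith)
    (fun j K => by
      refine (hlin j K).trans ?_
      have h8 : (8 : ℝ) ^ j = (2 ^ j) ^ 3 := by rw [← pow_mul, mul_comm, pow_mul]; norm_num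
      rw [h8, mul_div_assoc, ← div_pow, mul_div_assoc]
      have h1 := haM j
      have h2 := (ha0 j).le
      gcongr)
  have hE0 : 0 ≤ E := by simpa using (abs_nonneg _).trans (hE 0 0)
  have haL : ∀ j, L ≤ N₀ * 2 ^ j * a j := fun j => by
    have h1 := sub_le_mul_of_Δ_le (x := s j) (i := 0) (fun n _ => hΔa j _) (N₀ * 2 ^ j) le_rfl
    have h2 := hsper j 0
    push_cast at h1
    linarith
  have hD : ∀ j k, |Δ (Δ (s j)) k| ≤ E * N₀ ^ 2 / L ^ 2 * a j ^ 2 := fun j k => by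
    refine (hE j k).trans ?_
    have h1 : L ^ 2 ≤ (N₀ * 2 ^ j * a j) ^ 2 := pow_le_pow_left₀ hL.le (haL j) 2
    have h4 : (4 : ℝ) ^ j = (2 ^ j) ^ 2 := by rw [← pow_mul, mul_comm, pow_mul]; norm_num
    rw [h4, div_mul_eq_mul_div, div_le_div_iff₀ (by positivity) (by positivity)]
    calc E * L ^ 2 ≤ E * (N₀ * 2 ^ j * a j) ^ 2 := by gcongr
      _ = _ := by ring
  set D := E * N₀ ^ 2 / L ^ 2 with hDdef
  have hD0 : 0 ≤ D := by positivity
  refine ⟨P * (1 + P * D) * (1 + (4 * B / κ * P ^ 2 + 2 * P * D) / 2) + D +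
    2 * B * P ^ 3 * L, ?_, fun j hj K => ?_⟩
  · have : (0 : ℝ) < P := by rw [hP]; positivity
    positivity
  · obtain ⟨j, rfl⟩ := Nat.exists_eq_add_of_le' hj
    simp only [Nat.add_sub_cancel]
    rw [← ha j]
    obtain ⟨c1, c2, c3, c4⟩ := hlocal j K (K / 2) (by omega) (by omega)
    exact abs_sub_le_of_S_Δ_sq_le hP (by omega) (by omega) (hmono j) (hΔa j)
      (ha_le j L (hΔL j)) hD0 (by positivity) (by positivity) (hD j) c4.1 c4.2 c3.1 c3.2 c1 c2
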